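/- arXiv:1209.1534 — 5 statements merged into one kernel-verified Lean document; each statement's English description precedes it below -/
import Mathlib

section
/- There is no sequence p_n → +∞ along which (r_{p_n} − s_{p_n})/ε_{p_n}⁺ → 0; equivalently, limsup_{p→+∞} (r_p − s_p)/ε_p⁺ < 0. -/
open Real MeasureTheory Set Filter

noncomputable section

/-- The radial energy functional for the Lane–Emden problem on the unit ball of `ℝ²`
(written in polar coordinates; the common factor `2π` is dropped). -/
def radialEnergy (p : ℝ) (v : ℝ → ℝ) : ℝ :=
  (1 / 2) * (∫ r in (0:ℝ)..1, (deriv v r) ^ 2 * r)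
    - (1 / (p + 1)) * ∫ r in (0:ℝ)..1, |v r| ^ (p + 1) * r

/-- The Nehari identity `∫_B |∇v⁺|² = ∫_B |v⁺|^{p+1}` for the positive part,
written in polar coordinates. -/
def nehariPos (p : ℝ) (v : ℝ → ℝ) : Prop :=
  (∫ r in (0:ℝ)..1, (if 0 < v r then (deriv v r) ^ 2 * r else 0))
    = ∫ r in (0:ℝ)..1, (max (v r) 0) ^ (p + 1) * r

/-- The Nehari identity `∫_B |∇v⁻|² = ∫_B |v⁻|^{p+1}` for the negative part,
written in polar coordinates. -/
def nehariNeg (p : ℝ) (v : ℝ → ℝ) : Prop :=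
  (∫ r in (0:ℝ)..1, (if v r < 0 then (deriv v r) ^ 2 * r else 0))
    = ∫ r in (0:ℝ)..1, (max (-v r) 0) ^ (p + 1) * r

/-- A family `p ↦ u p` (for `p > 1`) of least energy nodal radial solutions of the
Lane–Emden problem `−Δu = |u|^{p−1}u` in the unit ball `B ⊆ ℝ²`, `u = 0` on `∂B`,
described through the radial profile `u p : ℝ → ℝ`.  `rp p ∈ (0,1)` is the nodal
radius, `sp p ∈ (rp p, 1)` is a radius where `u p` attains `‖(u p)⁺‖_∞`; the solution
is negative in the inner nodal region (`u p 0 < 0`), attains `-‖(u p)⁻‖_∞` at `0`,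
and minimizes the energy among radial members of the nodal Nehari set. -/
structure LaneEmdenFamily where
  u : ℝ → ℝ → ℝ
  rp : ℝ → ℝ
  sp : ℝ → ℝ
  smooth : ∀ p, 1 < p → ContDiffOn ℝ 2 (u p) (Icc (0:ℝ) 1)
  ode : ∀ p, 1 < p → ∀ r ∈ Ioo (0:ℝ) 1,
    -deriv (deriv (u p)) r - deriv (u p) r / r = |u p r| ^ (p - 1) * u p r
  derivAtZero : ∀ p, 1 < p → deriv (u p) 0 = 0
  boundary : ∀ p, 1 < p → u p 1 = 0
  center_neg : ∀ p, 1 < p → u p 0 < 0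
  min_at_zero : ∀ p, 1 < p → ∀ r ∈ Icc (0:ℝ) 1, u p 0 ≤ u p r
  rp_mem : ∀ p, 1 < p → rp p ∈ Ioo (0:ℝ) 1
  rp_zero : ∀ p, 1 < p → u p (rp p) = 0
  neg_in : ∀ p, 1 < p → ∀ r ∈ Ico (0:ℝ) (rp p), u p r < 0
  pos_out : ∀ p, 1 < p → ∀ r ∈ Ioo (rp p) 1, 0 < u p r
  sp_mem : ∀ p, 1 < p → sp p ∈ Ioo (rp p) 1
  sp_max : ∀ p, 1 < p → ∀ r ∈ Icc (0:ℝ) 1, u p r ≤ u p (sp p)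
  least_energy : ∀ p, 1 < p → ∀ v : ℝ → ℝ,
    ContDiffOn ℝ 1 v (Icc (0:ℝ) 1) → v 1 = 0 →
    (∃ r ∈ Ioo (0:ℝ) 1, 0 < v r) → (∃ r ∈ Ioo (0:ℝ) 1, v r < 0) →
    nehariPos p v → nehariNeg p v →
    radialEnergy p (u p) ≤ radialEnergy p v

/-- `ε_p⁺`, defined by `(ε_p⁺)⁻² = p · ‖u_p⁺‖_∞^{p−1} = p · u_p(s_p)^{p−1}`. -/
def epsP (F : LaneEmdenFamily) (p : ℝ) : ℝ :=
  1 / Real.sqrt (p * F.u p (F.sp p) ^ (p - 1))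

/-- `ε_p⁻`, defined by `(ε_p⁻)⁻² = p · ‖u_p⁻‖_∞^{p−1} = p · |u_p(0)|^{p−1}`. -/
def epsM (F : LaneEmdenFamily) (p : ℝ) : ℝ :=
  1 / Real.sqrt (p * (-F.u p 0) ^ (p - 1))

/-- The profile is differentiable on `(0,1)`. -/
lemma LaneEmdenFamily.hasDerivAt_u (F : LaneEmdenFamily) {p t : ℝ} (hp : 1 < p)
    (ht : t ∈ Ioo (0:ℝ) 1) : HasDerivAt (F.u p) (deriv (F.u p) t) t := by
  have h := ((F.smooth p hp).contDiffAt (Icc_mem_nhds ht.1 ht.2)).differentiableAt (by norm_num)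
  exact h.hasDerivAt

/-- The radial flux `t ↦ t * deriv u t`, continuous up to the endpoints of `[0,1]`. -/
def LaneEmdenFamily.flux (F : LaneEmdenFamily) (p t : ℝ) : ℝ :=
  t * derivWithin (F.u p) (Icc (0:ℝ) 1) t

lemma LaneEmdenFamily.continuousOn_flux (F : LaneEmdenFamily) {p : ℝ} (hp : 1 < p) :
    ContinuousOn (F.flux p) (Icc (0:ℝ) 1) :=
  continuousOn_id.mul ((F.smooth p hp).continuousOn_derivWithin
    (uniqueDiffOn_Icc zero_lt_one) (by norm_num))

lemma LaneEmdenFamily.flux_eq (F : LaneEmdenFamily) (p : ℝ) {t : ℝ} (ht : t ∈ Ioo (0:ℝ) 1) :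
    F.flux p t = t * deriv (F.u p) t := by
  rw [flux, derivWithin_of_mem_nhds (Icc_mem_nhds ht.1 ht.2)]

/-- The radial equation in divergence form. -/
lemma LaneEmdenFamily.hasDerivAt_flux (F : LaneEmdenFamily) {p t : ℝ} (hp : 1 < p)
    (ht : t ∈ Ioo (0:ℝ) 1) :
    HasDerivAt (F.flux p) (-(t * (|F.u p t| ^ (p - 1) * F.u p t))) t := by
  have h2 : ContDiffOn ℝ 2 (F.u p) (Ioo 0 1) := (F.smooth p hp).mono Ioo_subset_Icc_self
  have h1 : ContDiffOn ℝ 1 (deriv (F.u p)) (Ioo 0 1) :=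
    h2.deriv_of_isOpen isOpen_Ioo (by norm_num)
  have hd : HasDerivAt (deriv (F.u p)) (deriv (deriv (F.u p)) t) t :=
    ((h1.contDiffAt (Ioo_mem_nhds ht.1 ht.2)).differentiableAt (by norm_num)).hasDerivAt
  have heq : F.flux p =ᶠ[nhds t] fun t => t * deriv (F.u p) t := by
    filter_upwards [Ioo_mem_nhds ht.1 ht.2] with x hx using F.flux_eq p hx
  refine HasDerivAt.congr_of_eventuallyEq ?_ heq
  refine ((hasDerivAt_id' t).mul hd).congr_deriv ?_
  have ht0 : t ≠ 0 := ht.1.ne'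
  rw [← F.ode p hp t ht]
  field_simp
  ring

/-- The derivative of the flux where the profile is negative. -/
lemma LaneEmdenFamily.hasDerivAt_flux_of_neg (F : LaneEmdenFamily) {p t : ℝ} (hp : 1 < p)
    (ht : t ∈ Ioo (0:ℝ) 1) (hu : F.u p t < 0) :
    HasDerivAt (F.flux p) (t * (-F.u p t) ^ p) t := by
  refine (F.hasDerivAt_flux hp ht).congr_deriv ?_
  have h : (-F.u p t) ^ p = (-F.u p t) ^ (p - 1) * (-F.u p t) := by
    rw [← rpow_add_one (by linarith)]; ring_nf
  rw [abs_of_neg hu, h]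
  ring

/-- The derivative of the flux where the profile is positive. -/
lemma LaneEmdenFamily.hasDerivAt_flux_of_pos (F : LaneEmdenFamily) {p t : ℝ} (hp : 1 < p)
    (ht : t ∈ Ioo (0:ℝ) 1) (hu : 0 < F.u p t) :
    HasDerivAt (F.flux p) (-(t * F.u p t ^ p)) t := by
  refine (F.hasDerivAt_flux hp ht).congr_deriv ?_
  have h : F.u p t ^ p = F.u p t ^ (p - 1) * F.u p t := by
    rw [← rpow_add_one hu.ne']; ring_nf
  rw [abs_of_pos hu, h]

lemma LaneEmdenFamily.u_sp_pos (F : LaneEmdenFamily) {p : ℝ} (hp : 1 < p) :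
    0 < F.u p (F.sp p) := F.pos_out p hp _ (F.sp_mem p hp)

lemma LaneEmdenFamily.flux_sp (F : LaneEmdenFamily) {p : ℝ} (hp : 1 < p) :
    F.flux p (F.sp p) = 0 := by
  have hr := F.rp_mem p hp
  have hs := F.sp_mem p hp
  have hs' : F.sp p ∈ Ioo (0:ℝ) 1 := ⟨hr.1.trans hs.1, hs.2⟩
  have hmax : IsLocalMax (F.u p) (F.sp p) := by
    filter_upwards [Icc_mem_nhds hs'.1 hs'.2] with x hx using F.sp_max p hp x hx
  rw [F.flux_eq p hs', hmax.deriv_eq_zero, mul_zero]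

/-- Between the nodal radius and the maximum point, the flux is controlled by the maximum. -/
lemma LaneEmdenFamily.flux_le (F : LaneEmdenFamily) {p t : ℝ} (hp : 1 < p)
    (ht : t ∈ Icc (F.rp p) (F.sp p)) :
    F.flux p t ≤ F.u p (F.sp p) ^ p * (F.sp p ^ 2 - t ^ 2) / 2 := by
  have hr := F.rp_mem p hp
  have hs := F.sp_mem p hp
  set M := F.u p (F.sp p) with hM
  have hsub : Icc (F.rp p) (F.sp p) ⊆ Icc 0 1 := Icc_subset_Icc hr.1.le hs.2.le
  have hmono : MonotoneOn (fun x => F.flux p x + M ^ p / 2 * x ^ 2)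
      (Icc (F.rp p) (F.sp p)) := by
    refine monotoneOn_of_hasDerivWithinAt_nonneg
      (f' := fun x => -(x * F.u p x ^ p) + M ^ p / 2 * (2 * x)) (convex_Icc _ _)
      (((F.continuousOn_flux hp).mono hsub).add (by fun_prop)) ?_ ?_
    · intro x hx
      rw [interior_Icc] at hx
      have hx1 : x ∈ Ioo (0:ℝ) 1 := ⟨hr.1.trans hx.1, hx.2.trans hs.2⟩
      have h := (F.hasDerivAt_flux_of_pos hp hx1
        (F.pos_out p hp x ⟨hx.1, hx1.2⟩)).add ((hasDerivAt_pow 2 x).const_mul (M ^ p / 2))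
      exact (h.congr_deriv (by norm_num)).hasDerivWithinAt
    · intro x hx
      rw [interior_Icc] at hx
      have hx1 : x ∈ Ioo (0:ℝ) 1 := ⟨hr.1.trans hx.1, hx.2.trans hs.2⟩
      have hle : F.u p x ^ p ≤ M ^ p :=
        rpow_le_rpow (F.pos_out p hp x ⟨hx.1, hx1.2⟩).le
          (F.sp_max p hp x (Ioo_subset_Icc_self hx1)) (by linarith)
      nlinarith [mul_le_mul_of_nonneg_left hle hx1.1.le]
  have h := hmono ht (right_mem_Icc.2 hs.1.le) ht.2
  simp only [F.flux_sp hp] at h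
  linarith

/-- The mean value inequality between the nodal radius and the maximum point. -/
lemma LaneEmdenFamily.two_mul_rp_mul_le (F : LaneEmdenFamily) {p : ℝ} (hp : 1 < p) :
    2 * F.rp p * p ≤ (F.sp p - F.rp p) ^ 2 * (F.sp p + F.rp p)
      * (p * F.u p (F.sp p) ^ (p - 1)) := by
  have hr := F.rp_mem p hp
  have hs := F.sp_mem p hp
  have hM0 := F.u_sp_pos hp
  have hsub : Icc (F.rp p) (F.sp p) ⊆ Icc 0 1 := Icc_subset_Icc hr.1.le hs.2.le
  obtain ⟨c, hc, hceq⟩ := exists_hasDerivAt_eq_slope (F.u p) (deriv (F.u p)) hs.1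
    ((F.smooth p hp).continuousOn.mono hsub)
    (fun x hx => F.hasDerivAt_u hp ⟨hr.1.trans hx.1, hx.2.trans hs.2⟩)
  have hc1 : c ∈ Ioo (0:ℝ) 1 := ⟨hr.1.trans hc.1, hc.2.trans hs.2⟩
  have hfl := F.flux_le hp (Ioo_subset_Icc_self hc)
  rw [F.flux_eq p hc1, hceq, F.rp_zero p hp, sub_zero] at hfl
  have hpow : F.u p (F.sp p) ^ p = F.u p (F.sp p) ^ (p - 1) * F.u p (F.sp p) := by
    rw [← rpow_add_one hM0.ne']; ring_nf
  rw [hpow] at hfl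
  set M := F.u p (F.sp p)
  set s := F.sp p
  set r := F.rp p
  set Q := M ^ (p - 1)
  have hQ : 0 < Q := rpow_pos_of_pos hM0 _
  have hd : 0 < s - r := sub_pos.2 hs.1
  have h1 : c * M ≤ Q * M * (s ^ 2 - c ^ 2) / 2 * (s - r) := by
    have := mul_le_mul_of_nonneg_right hfl hd.le
    rwa [mul_assoc, div_mul_cancel₀ _ hd.ne'] at this
  have h2 : c ≤ Q * (s ^ 2 - c ^ 2) / 2 * (s - r) := by
    refine le_of_mul_le_mul_right ?_ hM0
    linarith
  have h3 : r ^ 2 ≤ c ^ 2 := pow_le_pow_left₀ hr.1.le hc.1.le 2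
  have h4 : Q * (s ^ 2 - c ^ 2) / 2 * (s - r) ≤ Q * (s ^ 2 - r ^ 2) / 2 * (s - r) := by
    gcongr
  have h5 : 2 * r ≤ Q * (s ^ 2 - r ^ 2) * (s - r) := by linarith [hc.1]
  have h6 := mul_le_mul_of_nonneg_right h5 (zero_le_one.trans hp.le)
  linarith

lemma LaneEmdenFamily.flux_rp_pos (F : LaneEmdenFamily) {p : ℝ} (hp : 1 < p) :
    0 < F.flux p (F.rp p) := by
  have hr := F.rp_mem p hp
  have hmono : StrictMonoOn (F.flux p) (Icc 0 (F.rp p)) := by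
    refine strictMonoOn_of_hasDerivWithinAt_pos (f' := fun x => x * (-F.u p x) ^ p)
      (convex_Icc _ _) ((F.continuousOn_flux hp).mono (Icc_subset_Icc_right hr.2.le)) ?_ ?_
    all_goals
      intro x hx
      rw [interior_Icc] at hx
      have hx1 : x ∈ Ioo (0:ℝ) 1 := ⟨hx.1, hx.2.trans hr.2⟩
      have hu := F.neg_in p hp x ⟨hx.1.le, hx.2⟩
    · exact (F.hasDerivAt_flux_of_neg hp hx1 hu).hasDerivWithinAt
    · exact mul_pos hx.1 (rpow_pos_of_pos (neg_pos.2 hu) _)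
  have h := hmono (left_mem_Icc.2 hr.1.le) (right_mem_Icc.2 hr.1.le) hr.1
  simpa [flux] using h

/-- A truncation bound for powers. -/
lemma rpow_le_rpow_add_one_div_add {a l p : ℝ} (ha : 0 < a) (hl : 0 < l) (hp : 0 < p) :
    a ^ p ≤ a ^ (p + 1) / l + l ^ p := by
  rcases le_total l a with h | h
  · have h1 : a ^ p ≤ a ^ (p + 1) / l := by
      rw [le_div_iff₀ hl, rpow_add_one ha.ne']
      gcongr
    linarith [rpow_pos_of_pos hl p]
  · have h1 : a ^ p ≤ l ^ p := rpow_le_rpow ha.le h hp.le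
    have h2 : 0 < a ^ (p + 1) / l := by positivity
    linarith

/-- A Pohozaev-type estimate for the flux through the nodal circle. -/
lemma LaneEmdenFamily.flux_rp_le (F : LaneEmdenFamily) {p l : ℝ} (hp : 1 < p) (hl : 0 < l) :
    F.flux p (F.rp p) ≤
      (p + 1) / (4 * l) * F.flux p (F.rp p) ^ 2 + l ^ p / 2 * F.rp p ^ 2 := by
  have hr := F.rp_mem p hp
  have hsub : Icc 0 (F.rp p) ⊆ Icc 0 1 := Icc_subset_Icc_right hr.2.le
  have hp1 : 0 < p + 1 := by linarith
  have hmono : MonotoneOn (fun x => (p + 1) / (4 * l) * F.flux p x ^ 2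
      + 1 / (2 * l) * (x ^ 2 * (-F.u p x) ^ (p + 1)) + l ^ p / 2 * x ^ 2 - F.flux p x)
      (Icc 0 (F.rp p)) := by
    have hcf := (F.continuousOn_flux hp).mono hsub
    have hcu := (F.smooth p hp).continuousOn.mono hsub
    have hcr : ContinuousOn (fun x => (-F.u p x) ^ (p + 1)) (Icc 0 (F.rp p)) :=
      hcu.neg.rpow_const fun _ _ => Or.inr hp1.le
    refine monotoneOn_of_hasDerivWithinAt_nonneg
      (f' := fun x => x * ((-F.u p x) ^ (p + 1) / l + l ^ p - (-F.u p x) ^ p))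
      (convex_Icc _ _) (by fun_prop) ?_ ?_
    all_goals
      intro x hx
      rw [interior_Icc] at hx
      have hx1 : x ∈ Ioo (0:ℝ) 1 := ⟨hx.1, hx.2.trans hr.2⟩
      have hu := F.neg_in p hp x ⟨hx.1.le, hx.2⟩
    · have hf := F.hasDerivAt_flux_of_neg hp hx1 hu
      have hw : HasDerivAt (fun x => (-F.u p x) ^ (p + 1))
          (-deriv (F.u p) x * (p + 1) * (-F.u p x) ^ (p + 1 - 1)) x :=
        (F.hasDerivAt_u hp hx1).fun_neg.rpow_const (Or.inr (by linarith))
      have hsq := hasDerivAt_pow 2 x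
      have h := ((((hf.fun_pow 2).const_mul ((p + 1) / (4 * l))).fun_add
        ((hsq.fun_mul hw).const_mul (1 / (2 * l)))).fun_add (hsq.const_mul (l ^ p / 2))).fun_sub hf
      refine (h.congr_deriv ?_).hasDerivWithinAt
      rw [F.flux_eq p hx1, add_sub_cancel_right]
      field_simp
      ring
    · have := rpow_le_rpow_add_one_div_add (neg_pos.2 hu) hl (zero_lt_one.trans hp)
      exact mul_nonneg hx.1.le (by linarith)
  have h := hmono (left_mem_Icc.2 hr.1.le) (right_mem_Icc.2 hr.1.le) hr.1.le
  simp only [F.rp_zero p hp, neg_zero, zero_rpow hp1.ne', flux, zero_mul] at h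
  simp only [flux]
  norm_num at h
  linarith

/-- The maximum point of the positive part is at least `ε_p⁺` away from the origin. -/
lemma LaneEmdenFamily.one_le_sp_sq_mul (F : LaneEmdenFamily) {p : ℝ} (hp : 1 < p) :
    1 ≤ F.sp p ^ 2 * (p * F.u p (F.sp p) ^ (p - 1)) := by
  by_contra! hlt
  have hr := F.rp_mem p hp
  have hs := F.sp_mem p hp
  have hM := F.u_sp_pos hp
  have hI := F.flux_rp_pos hp
  have hIle := F.flux_le hp (left_mem_Icc.2 hs.1.le)
  have hpow : F.u p (F.sp p) ^ p = F.u p (F.sp p) ^ (p - 1) * F.u p (F.sp p) := by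
    rw [← rpow_add_one hM.ne']; ring_nf
  have hp0 : 0 < p := zero_lt_one.trans hp
  set I := F.flux p (F.rp p) with hIdef
  obtain ⟨l, hl, hlI⟩ : ∃ l : ℝ, 0 < l ∧ l ^ p * F.rp p ^ 2 = I := by
    have h0 : 0 < I / F.rp p ^ 2 := div_pos hI (pow_pos hr.1 2)
    refine ⟨(I / F.rp p ^ 2) ^ p⁻¹, rpow_pos_of_pos h0 _, ?_⟩
    rw [rpow_inv_rpow h0.le hp0.ne', div_mul_cancel₀ _ (pow_pos hr.1 2).ne']
  have hpoh := F.flux_rp_le hp hl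
  rw [← hIdef] at hpoh
  have h1 : 2 * l ≤ (p + 1) * I := by
    have h2 : I / 2 ≤ (p + 1) / (4 * l) * I ^ 2 := by linarith
    have h3 : (p + 1) / (4 * l) * I ^ 2 = ((p + 1) * I) / (4 * l) * I := by ring
    rw [h3] at h2
    have h4 : 1 / 2 ≤ (p + 1) * I / (4 * l) := le_of_mul_le_mul_right (by linarith) hI
    rw [le_div_iff₀ (by positivity)] at h4
    linarith
  set M := F.u p (F.sp p)
  set s := F.sp p
  set r := F.rp p
  have hQ : 0 < M ^ (p - 1) := rpow_pos_of_pos hM _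
  have hMI : p * I ≤ M / 2 := by
    have h2 : I ≤ M ^ (p - 1) * M * s ^ 2 / 2 := by
      rw [hpow] at hIle
      have : 0 ≤ M ^ (p - 1) * M * r ^ 2 := by positivity
      linarith
    have h3 := mul_le_mul_of_nonneg_left h2 hp0.le
    have h4 := mul_lt_mul_of_pos_right hlt hM
    linarith
  have hlM : l ≤ M := by nlinarith
  have hlp : l ^ (p - 1) ≤ M ^ (p - 1) := rpow_le_rpow hl.le hlM (by linarith)
  have hlpow : l ^ p = l ^ (p - 1) * l := by
    rw [← rpow_add_one hl.ne']; ring_nf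
  have h5 : 2 ≤ (p + 1) * (l ^ (p - 1) * r ^ 2) := by
    refine le_of_mul_le_mul_right ?_ hl
    rw [← hlI, hlpow] at h1
    linarith
  have hrs : r ^ 2 ≤ s ^ 2 := pow_le_pow_left₀ hr.1.le hs.1.le 2
  have h6 : l ^ (p - 1) * r ^ 2 ≤ M ^ (p - 1) * s ^ 2 :=
    mul_le_mul hlp hrs (sq_nonneg _) hQ.le
  have h7 : 0 < M ^ (p - 1) * s ^ 2 := lt_of_lt_of_le (by nlinarith) h6
  nlinarith

/-- The nodal radius and the maximum point stay uniformly apart at the scale `ε_p⁺`. -/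
lemma LaneEmdenFamily.rp_sub_sp_div_epsP_le (F : LaneEmdenFamily) {p : ℝ} (hp : 1 < p) :
    (F.rp p - F.sp p) / epsP F p ≤ -(1 / 2) := by
  have hr := F.rp_mem p hp
  have hs := F.sp_mem p hp
  have h1 := F.one_le_sp_sq_mul hp
  have h2 := F.two_mul_rp_mul_le hp
  rw [epsP, div_div_eq_mul_div, div_one]
  have hq : 0 < p * F.u p (F.sp p) ^ (p - 1) :=
    mul_pos (zero_lt_one.trans hp) (rpow_pos_of_pos (F.u_sp_pos hp) _)
  set q := p * F.u p (F.sp p) ^ (p - 1)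
  set s := F.sp p
  set r := F.rp p
  have hr0 : 0 < r := hr.1
  have hrs : r < s := hs.1
  by_contra! hlt
  have hx : (s - r) * √q < 1 / 2 := by linarith
  have hx0 : 0 ≤ (s - r) * √q := mul_nonneg (sub_pos.2 hrs).le (sqrt_nonneg q)
  have hsq : (s - r) ^ 2 * q < 1 / 4 := by
    have h3 : ((s - r) * √q) ^ 2 < (1 / 2) ^ 2 := pow_lt_pow_left₀ hx hx0 two_ne_zero
    rw [mul_pow, sq_sqrt hq.le] at h3
    linarith
  have h4 : (2 * (s - r)) ^ 2 < s ^ 2 := by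
    refine lt_of_mul_lt_mul_right ?_ hq.le
    linarith
  have h5 : 2 * (s - r) < s := lt_of_pow_lt_pow_left₀ 2 (hr0.trans hrs).le h4
  have h6 : (s - r) ^ 2 * q * (s + r) ≤ 1 / 4 * (s + r) :=
    mul_le_mul_of_nonneg_right hsq.le (by linarith)
  nlinarith

/-- There is no sequence `p_n → +∞` along which
`(r_{p_n} − s_{p_n})/ε_{p_n}⁺ → 0`. -/
theorem no_seq_tendsto_zero (F : LaneEmdenFamily) :
    ¬ ∃ pn : ℕ → ℝ, (∀ n, 1 < pn n) ∧ Tendsto pn atTop atTop ∧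
      Tendsto (fun n => (F.rp (pn n) - F.sp (pn n)) / epsP F (pn n)) atTop (nhds 0) := by
  rintro ⟨pn, hpn, -, hlim⟩
  have h := le_of_tendsto' hlim fun n => F.rp_sub_sp_div_epsP_le (hpn n)
  norm_num at h
end
end

section
/- If along a sequence p_n → +∞ one has (r_{p_n} − s_{p_n})/ε_{p_n}⁺ → −l for some l > 0, then s_{p_n}/ε_{p_n}⁺ → l along the same sequence; in particular r_{p_n}/ε_{p_n}⁺ → 0 and s_{p_n} → 0. -/
open Real MeasureTheory Set Filter

noncomputable section

namespace LaneEmdenFamily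

variable (F : LaneEmdenFamily) {p : ℝ}

lemma zero_lt_rp (hp : 1 < p) : 0 < F.rp p := (F.rp_mem p hp).1

lemma rp_lt_sp (hp : 1 < p) : F.rp p < F.sp p := (F.sp_mem p hp).1

lemma sp_lt_one (hp : 1 < p) : F.sp p < 1 := (F.sp_mem p hp).2

lemma u_sp_pos_s7 (hp : 1 < p) : 0 < F.u p (F.sp p) := F.pos_out p hp _ (F.sp_mem p hp)

lemma u_nonneg_of_rp_le (hp : 1 < p) {r : ℝ} (h₁ : F.rp p ≤ r) (h₂ : r < 1) : 0 ≤ F.u p r := by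
  rcases h₁.eq_or_lt with rfl | h
  · exact (F.rp_zero p hp).ge
  · exact (F.pos_out p hp r ⟨h, h₂⟩).le

lemma contDiffAt (hp : 1 < p) {r : ℝ} (hr : r ∈ Ioo (0:ℝ) 1) : ContDiffAt ℝ 2 (F.u p) r :=
  (F.smooth p hp).contDiffAt (Icc_mem_nhds hr.1 hr.2)

lemma differentiableAt (hp : 1 < p) {r : ℝ} (hr : r ∈ Ioo (0:ℝ) 1) :
    DifferentiableAt ℝ (F.u p) r :=
  (F.contDiffAt hp hr).differentiableAt (by norm_num)

lemma differentiableAt_deriv (hp : 1 < p) {r : ℝ} (hr : r ∈ Ioo (0:ℝ) 1) :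
    DifferentiableAt ℝ (deriv (F.u p)) r :=
  ((F.contDiffAt hp hr).derivWithin (m := 1) (by norm_num)).differentiableAt (by norm_num)

lemma deriv_u_sp (hp : 1 < p) : deriv (F.u p) (F.sp p) = 0 := by
  have h0 := (F.zero_lt_rp hp).trans (F.rp_lt_sp hp)
  refine IsLocalMax.deriv_eq_zero ?_
  filter_upwards [Icc_mem_nhds h0 (F.sp_lt_one hp)] with r hr using F.sp_max p hp r hr

/-- The flux `r u'(r)`, corrected by the largest possible source term, is nondecreasing on the
outer nodal region. -/
lemma monotoneOn_flux (hp : 1 < p) :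
    MonotoneOn (fun r ↦ r * deriv (F.u p) r
      + F.u p (F.sp p) ^ (p - 1) * F.u p (F.sp p) * r ^ 2 / 2) (Ico (F.rp p) 1) := by
  have key : ∀ r ∈ Ico (F.rp p) 1, HasDerivAt (fun r ↦ r * deriv (F.u p) r
      + F.u p (F.sp p) ^ (p - 1) * F.u p (F.sp p) * r ^ 2 / 2)
      (r * (F.u p (F.sp p) ^ (p - 1) * F.u p (F.sp p) - |F.u p r| ^ (p - 1) * F.u p r)) r := by
    intro r hr
    have hr0 : 0 < r := (F.zero_lt_rp hp).trans_le hr.1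
    have hmem : r ∈ Ioo (0:ℝ) 1 := ⟨hr0, hr.2⟩
    have hd := ((hasDerivAt_id r).mul (F.differentiableAt_deriv hp hmem).hasDerivAt).add
      ((((hasDerivAt_id r).pow 2).const_mul
        (F.u p (F.sp p) ^ (p - 1) * F.u p (F.sp p))).div_const 2)
    refine hd.congr_deriv ?_
    rw [← F.ode p hp r hmem]
    simp only [id]
    field_simp
    push_cast
    ring
  refine monotoneOn_of_deriv_nonneg (convex_Ico _ _)
    (fun r hr ↦ (key r hr).continuousAt.continuousWithinAt)
    (fun r hr ↦ (key r (interior_subset hr)).differentiableAt.differentiableWithinAt) ?_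
  intro r hr
  have hr := interior_subset hr
  have hr0 : 0 < r := (F.zero_lt_rp hp).trans_le hr.1
  have hu := F.u_nonneg_of_rp_le hp hr.1 hr.2
  have hle := F.sp_max p hp r ⟨hr0.le, hr.2.le⟩
  rw [(key r hr).deriv, abs_of_nonneg hu]
  have := Real.rpow_le_rpow hu hle (by linarith : 0 ≤ p - 1)
  have hM := (F.u_sp_pos_s7 hp).le
  exact mul_nonneg hr0.le (sub_nonneg.2 (by gcongr))

/-- Integrating the equation from the nodal radius to the maximum point. -/
lemma two_mul_rp_le (hp : 1 < p) :
    2 * F.rp p ≤ F.u p (F.sp p) ^ (p - 1) * ((F.sp p - F.rp p) ^ 2 * (F.sp p + F.rp p)) := by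
  have hr := F.zero_lt_rp hp
  have hrs := F.rp_lt_sp hp
  have hs1 := F.sp_lt_one hp
  have hM := F.u_sp_pos_s7 hp
  have hds := F.deriv_u_sp hp
  have hmono := F.monotoneOn_flux hp
  have hr0 := F.rp_zero p hp
  have hdiff : ∀ x ∈ Icc (F.rp p) (F.sp p), DifferentiableAt ℝ (F.u p) x := fun x hx ↦
    F.differentiableAt hp ⟨hr.trans_le hx.1, hx.2.trans_lt hs1⟩
  set s := F.sp p
  set r := F.rp p
  set M := F.u p s
  have hQ : 0 < M ^ (p - 1) := Real.rpow_pos_of_pos hM _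
  have hmv := (convex_Icc r s).image_sub_le_mul_sub_of_deriv_le
    (f := F.u p) (C := M ^ (p - 1) * M * ((s - r) * (s + r)) / (2 * r))
    (fun x hx ↦ (hdiff x hx).continuousAt.continuousWithinAt)
    (fun x hx ↦ (hdiff x (interior_subset hx)).differentiableWithinAt)
    (fun x hx ↦ by
      obtain ⟨hrx, hxs⟩ := interior_subset hx
      have hx0 : 0 < x := hr.trans_le hrx
      have hflux := hmono (a := x) ⟨hrx, hxs.trans_lt hs1⟩ (b := s) ⟨hrs.le, hs1⟩ hxs
      simp only [hds, mul_zero, zero_add] at hflux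
      have hx' : deriv (F.u p) x ≤ M ^ (p - 1) * M * (s ^ 2 - x ^ 2) / (2 * x) := by
        rw [le_div_iff₀ (by positivity)]
        linarith
      refine hx'.trans ?_
      have hsq : s ^ 2 - x ^ 2 ≤ (s - r) * (s + r) := by nlinarith
      have hnn : 0 ≤ (s - r) * (s + r) := mul_nonneg (by linarith) (by linarith)
      gcongr)
    r (left_mem_Icc.2 hrs.le) s (right_mem_Icc.2 hrs.le) hrs.le
  rw [hr0, sub_zero, div_mul_eq_mul_div, le_div_iff₀ (by positivity)] at hmv
  refine le_of_mul_le_mul_left (a := M) ?_ hM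
  calc M * (2 * r) ≤ _ := hmv
    _ = _ := by ring

/-- Integrating the equation from the maximum point to the boundary. -/
lemma two_le_rpow (hp : 1 < p) : 2 ≤ F.u p (F.sp p) ^ (p - 1) := by
  have hr := F.zero_lt_rp hp
  have hrs := F.rp_lt_sp hp
  have hs1 := F.sp_lt_one hp
  have hM := F.u_sp_pos_s7 hp
  have hds := F.deriv_u_sp hp
  have hmono := F.monotoneOn_flux hp
  have hb := F.boundary p hp
  have hcont : ContinuousOn (F.u p) (Icc (F.sp p) 1) :=
    (F.smooth p hp).continuousOn.mono (Icc_subset_Icc_left (hr.trans hrs).le)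
  have hdiff : ∀ x ∈ Ioo (F.sp p) 1, DifferentiableAt ℝ (F.u p) x := fun x hx ↦
    F.differentiableAt hp ⟨(hr.trans hrs).trans hx.1, hx.2⟩
  set s := F.sp p
  set M := F.u p s
  have hQ : 0 < M ^ (p - 1) := Real.rpow_pos_of_pos hM _
  have hmv := (convex_Icc s 1).mul_sub_le_image_sub_of_le_deriv
    (f := F.u p) (C := -(M ^ (p - 1) * M / 2)) hcont
    (fun x hx ↦ (hdiff x (by rwa [interior_Icc] at hx)).differentiableWithinAt)
    (fun x hx ↦ by
      rw [interior_Icc] at hx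
      have hs0 : 0 < s := hr.trans hrs
      have hx0 : 0 < x := hs0.trans hx.1
      have hflux := hmono (a := s) ⟨hrs.le, hs1⟩ (b := x) ⟨(hrs.trans hx.1).le, hx.2⟩ hx.1.le
      simp only [hds, mul_zero, zero_add] at hflux
      have hK : 0 < M ^ (p - 1) * M := by positivity
      have h1 : 0 ≤ M ^ (p - 1) * M * s ^ 2 / 2 := by positivity
      have h2 : M ^ (p - 1) * M * x ^ 2 ≤ M ^ (p - 1) * M * x := by
        have : x ^ 2 ≤ x := by nlinarith [hx.2]
        gcongr
      refine le_of_mul_le_mul_left (a := x) ?_ hx0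
      linarith)
    s (left_mem_Icc.2 hs1.le) 1 (right_mem_Icc.2 hs1.le) hs1.le
  rw [hb] at hmv
  refine le_of_mul_le_mul_right (a := M) ?_ hM
  have : 0 ≤ M ^ (p - 1) * M * s := by
    have := hr.trans hrs
    positivity
  change _ ≤ 0 - M at hmv
  linarith

lemma epsP_pos (hp : 1 < p) : 0 < epsP F p := by
  have := F.two_le_rpow hp
  unfold epsP
  positivity

lemma mul_rpow_mul_epsP_sq (hp : 1 < p) :
    p * F.u p (F.sp p) ^ (p - 1) * epsP F p ^ 2 = 1 := by
  have := F.two_le_rpow hp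
  have h : 0 < p * F.u p (F.sp p) ^ (p - 1) := by positivity
  rw [epsP, div_pow, Real.sq_sqrt h.le]
  field_simp

lemma epsP_le (hp : 1 < p) : epsP F p ≤ √(p⁻¹) := by
  refine Real.le_sqrt_of_sq_le ?_
  have h1 := F.mul_rpow_mul_epsP_sq hp
  have h2 := F.two_le_rpow hp
  have hp0 : 0 < p := by linarith
  rw [← one_div, le_div_iff₀ hp0]
  nlinarith [mul_nonneg hp0.le (sq_nonneg (epsP F p))]

/-- The rescaled form of `two_mul_rp_le`. -/
lemma rp_div_epsP_mul_le (hp : 1 < p) :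
    F.rp p / epsP F p * (2 * (p - ((F.rp p - F.sp p) / epsP F p) ^ 2))
      ≤ -((F.rp p - F.sp p) / epsP F p) ^ 3 := by
  have he := F.epsP_pos hp
  have h1 := F.mul_rpow_mul_epsP_sq hp
  have h2 := F.two_mul_rp_le hp
  have hp0 : 0 < p := by linarith
  set e := epsP F p
  set r := F.rp p
  set s := F.sp p
  have h3 : 2 * r * p * e ^ 2 ≤ (s - r) ^ 2 * (s + r) := by
    calc 2 * r * p * e ^ 2 = 2 * r * (p * e ^ 2) := by ring
      _ ≤ F.u p s ^ (p - 1) * ((s - r) ^ 2 * (s + r)) * (p * e ^ 2) := by gcongr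
      _ = (p * F.u p s ^ (p - 1) * e ^ 2) * ((s - r) ^ 2 * (s + r)) := by ring
      _ = _ := by rw [h1, one_mul]
  have h4 : r / e * (2 * (p - ((r - s) / e) ^ 2)) =
      (2 * r * p * e ^ 2 - 2 * r * (r - s) ^ 2) / e ^ 3 := by field_simp
  have h5 : -((r - s) / e) ^ 3 = -(r - s) ^ 3 / e ^ 3 := by field_simp
  rw [h4, h5]
  gcongr
  linarith

end LaneEmdenFamily

/-- If along a sequence `p_n → +∞` one has
`(r_{p_n} − s_{p_n})/ε_{p_n}⁺ → −l` with `l > 0`, then `s_{p_n}/ε_{p_n}⁺ → l`;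
in particular `r_{p_n}/ε_{p_n}⁺ → 0` and `s_{p_n} → 0`. -/
theorem sp_over_eps_tendsto (F : LaneEmdenFamily) (pn : ℕ → ℝ) (hpn : ∀ n, 1 < pn n)
    (hto : Tendsto pn atTop atTop) (l : ℝ) (hl : 0 < l)
    (h : Tendsto (fun n => (F.rp (pn n) - F.sp (pn n)) / epsP F (pn n)) atTop (nhds (-l))) :
    Tendsto (fun n => F.sp (pn n) / epsP F (pn n)) atTop (nhds l) ∧
    Tendsto (fun n => F.rp (pn n) / epsP F (pn n)) atTop (nhds 0) ∧
    Tendsto (fun n => F.sp (pn n)) atTop (nhds 0) := by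
  have hpos : ∀ n, 0 < epsP F (pn n) := fun n ↦ F.epsP_pos (hpn n)
  have hR : Tendsto (fun n => F.rp (pn n) / epsP F (pn n)) atTop (nhds 0) := by
    have hden : Tendsto (fun n ↦ 2 * (pn n - ((F.rp (pn n) - F.sp (pn n)) / epsP F (pn n)) ^ 2))
        atTop atTop := by
      refine Tendsto.const_mul_atTop two_pos ?_
      simpa only [sub_eq_add_neg] using hto.atTop_add (h.pow 2).neg
    refine squeeze_zero' (.of_forall fun n ↦ ?_) ?_ ((h.pow 3).neg.div_atTop hden)
    · exact div_nonneg (F.zero_lt_rp (hpn n)).le (hpos n).le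
    · filter_upwards [hden.eventually_gt_atTop 0] with n hn
      rw [le_div_iff₀ hn]
      exact F.rp_div_epsP_mul_le (hpn n)
  have hS : Tendsto (fun n => F.sp (pn n) / epsP F (pn n)) atTop (nhds l) := by
    have := hR.sub h
    rw [sub_neg_eq_add, zero_add] at this
    refine this.congr fun n ↦ ?_
    ring
  have he : Tendsto (fun n ↦ epsP F (pn n)) atTop (nhds 0) := by
    refine squeeze_zero (fun n ↦ (hpos n).le) (fun n ↦ F.epsP_le (hpn n)) ?_
    simpa using (tendsto_inv_atTop_zero.comp hto).sqrt
  refine ⟨hS, hR, ?_⟩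
  have := hS.mul he
  rw [mul_zero] at this
  exact this.congr fun n ↦ div_mul_cancel₀ _ (hpos n).ne'
end
end

section
/- Let l > 0. The function Z_l is smooth on (0, +∞) and satisfies: −Z_l''(r) − Z_l'(r)/r = e^{Z_l(r)} for all r > 0; Z_l(r) ≤ 0 for all r > 0; Z_l(l) = 0 and Z_l'(l) = 0; and the integral identities ∫₀^l e^{Z_l(t)}·t dt = α − 2, ∫_l^{+∞} e^{Z_l(t)}·t dt = α + 2, and ∫₀^{+∞} e^{Z_l(t)}·t dt = 2α. -/
open Real MeasureTheory Set Filter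

noncomputable section

/-- `α = √(2l² + 4)`. -/
def alphaOf (l : ℝ) : ℝ := Real.sqrt (2 * l ^ 2 + 4)

/-- `β = ((α+2)/(α−2))^{1/α} · l`. -/
def betaOf (l : ℝ) : ℝ := ((alphaOf l + 2) / (alphaOf l - 2)) ^ (1 / alphaOf l) * l

/-- The singular Liouville profile `Z_l(r) = log(2α²β^α r^{α−2}/(β^α + r^α)²)`. -/
def Zl (l : ℝ) (r : ℝ) : ℝ :=
  Real.log (2 * alphaOf l ^ 2 * betaOf l ^ alphaOf l * r ^ (alphaOf l - 2)
    / (betaOf l ^ alphaOf l + r ^ alphaOf l) ^ 2)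

theorem alphaOf_sq (l : ℝ) : alphaOf l ^ 2 = 2 * l ^ 2 + 4 :=
  Real.sq_sqrt (by positivity)

theorem two_lt_alphaOf {l : ℝ} (hl : 0 < l) : 2 < alphaOf l :=
  Real.lt_sqrt_of_sq_lt (by nlinarith [sq_pos_of_pos hl])

theorem betaOf_rpow {l : ℝ} (hl : 0 < l) :
    betaOf l ^ alphaOf l = (alphaOf l + 2) / (alphaOf l - 2) * l ^ alphaOf l := by
  have ha := two_lt_alphaOf hl
  have hc : 0 ≤ (alphaOf l + 2) / (alphaOf l - 2) :=
    div_nonneg (by linarith) (by linarith)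
  rw [betaOf, Real.mul_rpow (Real.rpow_nonneg hc _) hl.le, ← Real.rpow_mul hc,
    one_div_mul_cancel (by linarith), Real.rpow_one]

theorem betaOf_rpow_pos {l : ℝ} (hl : 0 < l) : 0 < betaOf l ^ alphaOf l := by
  have ha := two_lt_alphaOf hl
  rw [betaOf_rpow hl]
  exact mul_pos (div_pos (by linarith) (by linarith)) (Real.rpow_pos_of_pos hl _)

theorem exp_Zl {l : ℝ} (hl : 0 < l) {r : ℝ} (hr : 0 < r) :
    Real.exp (Zl l r) = 2 * alphaOf l ^ 2 * betaOf l ^ alphaOf l * r ^ (alphaOf l - 2)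
      / (betaOf l ^ alphaOf l + r ^ alphaOf l) ^ 2 := by
  have ha := two_lt_alphaOf hl
  have hB := betaOf_rpow_pos hl
  exact Real.exp_log (by positivity)

theorem contDiffOn_Zl {l : ℝ} (hl : 0 < l) : ContDiffOn ℝ (⊤ : ℕ∞) (Zl l) (Ioi 0) := by
  have ha := two_lt_alphaOf hl
  have hB := betaOf_rpow_pos hl
  intro r hr
  have hr : 0 < r := hr
  apply ContDiffAt.contDiffWithinAt
  unfold Zl
  refine ContDiffAt.log (ContDiffAt.div ?_ ?_ (by positivity)) (by positivity)
  · exact contDiffAt_const.mul (Real.contDiffAt_rpow_const_of_ne hr.ne')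
  · exact (contDiffAt_const.add (Real.contDiffAt_rpow_const_of_ne hr.ne')).pow 2

theorem Zl_eq {l : ℝ} (hl : 0 < l) {r : ℝ} (hr : 0 < r) :
    Zl l r = Real.log (2 * alphaOf l ^ 2 * betaOf l ^ alphaOf l)
      + (alphaOf l - 2) * Real.log r - 2 * Real.log (betaOf l ^ alphaOf l + r ^ alphaOf l) := by
  have ha := two_lt_alphaOf hl
  have hB := betaOf_rpow_pos hl
  rw [Zl, Real.log_div (by positivity) (by positivity),
    Real.log_mul (by positivity) (by positivity), Real.log_rpow hr, Real.log_pow]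
  norm_num

theorem hasDerivAt_Zl {l : ℝ} (hl : 0 < l) {r : ℝ} (hr : 0 < r) :
    HasDerivAt (Zl l) ((alphaOf l - 2) / r - 2 * (alphaOf l * r ^ (alphaOf l - 1)
      / (betaOf l ^ alphaOf l + r ^ alphaOf l))) r := by
  have hB := betaOf_rpow_pos hl
  have h1 := ((Real.hasDerivAt_log hr.ne').const_mul (alphaOf l - 2)).const_add
    (Real.log (2 * alphaOf l ^ 2 * betaOf l ^ alphaOf l))
  have h2 := (((Real.hasDerivAt_rpow_const (p := alphaOf l) (Or.inl hr.ne')).const_add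
    (betaOf l ^ alphaOf l)).log (by positivity)).const_mul 2
  rw [div_eq_mul_inv]
  refine (h1.sub h2).congr_of_eventuallyEq ?_
  filter_upwards [Ioi_mem_nhds hr] with s hs
  exact Zl_eq hl hs

theorem Zl_liouville {l : ℝ} (hl : 0 < l) {r : ℝ} (hr : 0 < r) :
    -deriv (deriv (Zl l)) r - deriv (Zl l) r / r = Real.exp (Zl l r) := by
  have hB := betaOf_rpow_pos hl
  have h1 := ((hasDerivAt_id r).fun_inv hr.ne').const_mul (alphaOf l - 2)
  have h2 := ((((Real.hasDerivAt_rpow_const (p := alphaOf l - 1) (Or.inl hr.ne')).const_mul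
    (alphaOf l)).fun_div ((Real.hasDerivAt_rpow_const (p := alphaOf l) (Or.inl hr.ne')).const_add
    (betaOf l ^ alphaOf l)) (by positivity)).const_mul 2)
  have h3 := (h1.fun_sub h2).congr_of_eventuallyEq (f₁ := deriv (Zl l)) (by
    filter_upwards [Ioi_mem_nhds hr] with s hs
    rw [(hasDerivAt_Zl hl hs).deriv, div_eq_mul_inv, id])
  rw [h3.deriv, (hasDerivAt_Zl hl hr).deriv, exp_Zl hl hr,
    show alphaOf l - 1 - 1 = alphaOf l - 2 by ring]
  have e1 : r ^ (alphaOf l - 1) = r ^ (alphaOf l - 2) * r := by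
    rw [← Real.rpow_add_one hr.ne']; ring_nf
  have e2 : r ^ alphaOf l = r ^ (alphaOf l - 2) * r ^ 2 := by
    rw [← Real.rpow_natCast r 2, ← Real.rpow_add hr]; norm_num
  rw [e2] at *
  rw [e1]
  generalize betaOf l ^ alphaOf l = B at *
  have hx := Real.rpow_pos_of_pos hr (alphaOf l - 2)
  generalize r ^ (alphaOf l - 2) = x at *
  have hD : B + x * r ^ 2 ≠ 0 := by positivity
  simp only [id]
  field_simp
  ring

theorem Zl_nonpos {l : ℝ} (hl : 0 < l) {r : ℝ} (hr : 0 < r) : Zl l r ≤ 0 := by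
  have ha := two_lt_alphaOf hl
  have hB := betaOf_rpow_pos hl
  have hsq := alphaOf_sq l
  refine Real.log_nonpos (by positivity) ((div_le_one (by positivity)).2 ?_)
  rw [betaOf_rpow hl]
  generalize alphaOf l = a at *
  obtain ⟨s, hs, rfl⟩ : ∃ s, 0 < s ∧ r = l * s := ⟨r / l, by positivity, by field_simp⟩
  rw [Real.mul_rpow hl.le hs.le, Real.mul_rpow hl.le hs.le]
  have amgm := Real.geom_mean_le_arith_mean2_weighted (w₁ := (a + 2) / (2 * a))
    (w₂ := (a - 2) / (2 * a)) (p₁ := 1) (p₂ := s ^ a)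
    (div_nonneg (by linarith) (by linarith)) (div_nonneg (by linarith) (by linarith))
    zero_le_one (by positivity) (by field_simp; ring)
  rw [Real.one_rpow, ← Real.rpow_mul hs.le,
    show a * ((a - 2) / (2 * a)) = (a - 2) / 2 by field_simp] at amgm
  have e1 : s ^ (a - 2) = (s ^ ((a - 2) / 2)) ^ 2 := by
    rw [← Real.rpow_mul_natCast hs.le]; norm_num
  have e2 : l ^ a = l ^ (a - 2) * l ^ 2 := by
    rw [← Real.rpow_natCast l 2, ← Real.rpow_add hl]; norm_num
  rw [e1, e2]
  have hy := Real.rpow_pos_of_pos hs ((a - 2) / 2)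
  have hL := Real.rpow_pos_of_pos hl (a - 2)
  have hx := Real.rpow_pos_of_pos hs a
  generalize s ^ ((a - 2) / 2) = y at *
  generalize l ^ (a - 2) = L at *
  generalize s ^ a = x at *
  have amgm' : 2 * a * y ≤ (a + 2) + (a - 2) * x := by
    have := mul_le_mul_of_nonneg_left amgm (show 0 ≤ 2 * a by linarith)
    calc 2 * a * y = 2 * a * (1 * y) := by ring
      _ ≤ _ := this
      _ = _ := by field_simp
  have key : (2 * a * y) ^ 2 ≤ ((a + 2) + (a - 2) * x) ^ 2 :=
    pow_le_pow_left₀ (by positivity) amgm' 2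
  have ha2 : a - 2 ≠ 0 := by linarith
  have hl2 : l ^ 2 = (a - 2) * (a + 2) / 2 := by linarith
  have hK : 0 ≤ L ^ 2 * l ^ 2 * (a + 2) / (2 * (a - 2)) :=
    div_nonneg (by positivity) (by linarith)
  calc 2 * a ^ 2 * ((a + 2) / (a - 2) * (L * l ^ 2)) * (L * y ^ 2)
      = L ^ 2 * l ^ 2 * (a + 2) / (2 * (a - 2)) * (2 * a * y) ^ 2 := by field_simp
    _ ≤ L ^ 2 * l ^ 2 * (a + 2) / (2 * (a - 2)) * ((a + 2) + (a - 2) * x) ^ 2 := by gcongr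
    _ = ((a + 2) / (a - 2) * (L * l ^ 2) + L * l ^ 2 * x) ^ 2 := by
      rw [hl2]; field_simp

theorem Zl_self {l : ℝ} (hl : 0 < l) : Zl l l = 0 := by
  have ha := two_lt_alphaOf hl
  have hsq := alphaOf_sq l
  have e2 : l ^ alphaOf l = l ^ (alphaOf l - 2) * l ^ 2 := by
    rw [← Real.rpow_natCast l 2, ← Real.rpow_add hl]; norm_num
  have hL := Real.rpow_pos_of_pos hl (alphaOf l - 2)
  rw [Zl, betaOf_rpow hl, e2]
  generalize l ^ (alphaOf l - 2) = L at *
  generalize alphaOf l = a at *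
  have ha2 : a - 2 ≠ 0 := by linarith
  have hl2 : l ^ 2 = (a - 2) * (a + 2) / 2 := by linarith
  have hD : (a + 2) / (a - 2) * (L * l ^ 2) + L * l ^ 2 = 2 * a / (a - 2) * (L * l ^ 2) := by
    field_simp; ring
  rw [hD]
  convert Real.log_one
  have : a + 2 ≠ 0 := by linarith
  have : a ≠ 0 := by linarith
  rw [hl2]
  field_simp

theorem deriv_Zl_self {l : ℝ} (hl : 0 < l) : deriv (Zl l) l = 0 := by
  have ha := two_lt_alphaOf hl
  rw [(hasDerivAt_Zl hl hl).deriv, betaOf_rpow hl, Real.rpow_sub_one hl.ne']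
  have hL := Real.rpow_pos_of_pos hl (alphaOf l)
  generalize l ^ alphaOf l = L at *
  generalize alphaOf l = a at *
  have ha2 : a - 2 ≠ 0 := by linarith
  have : a ≠ 0 := by linarith
  have hD : (a + 2) / (a - 2) * L + L = 2 * a / (a - 2) * L := by
    field_simp; ring
  rw [hD]
  field_simp
  ring

/-- An antiderivative of `t ↦ exp (Zl l t) * t` on `(0, ∞)`, vanishing at infinity. -/
def ZlMass (l t : ℝ) : ℝ :=
  -(2 * alphaOf l * betaOf l ^ alphaOf l) / (betaOf l ^ alphaOf l + t ^ alphaOf l)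

theorem hasDerivAt_ZlMass {l : ℝ} (hl : 0 < l) {t : ℝ} (ht : 0 < t) :
    HasDerivAt (ZlMass l) (Real.exp (Zl l t) * t) t := by
  have hB := betaOf_rpow_pos hl
  have h := (hasDerivAt_const t (-(2 * alphaOf l * betaOf l ^ alphaOf l))).fun_div
    ((Real.hasDerivAt_rpow_const (p := alphaOf l) (Or.inl ht.ne')).const_add
    (betaOf l ^ alphaOf l)) (by positivity)
  refine h.congr_deriv ?_
  have e1 : t ^ (alphaOf l - 1) = t ^ (alphaOf l - 2) * t := by
    rw [← Real.rpow_add_one ht.ne']; ring_nf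
  rw [exp_Zl hl ht, e1]
  ring

theorem continuousWithinAt_ZlMass {l : ℝ} (hl : 0 < l) {a : ℝ} (ha : 0 ≤ a) :
    ContinuousWithinAt (ZlMass l) (Ici a) a := by
  have hB := betaOf_rpow_pos hl
  have h2 := two_lt_alphaOf hl
  apply ContinuousAt.continuousWithinAt
  unfold ZlMass
  refine continuousAt_const.div (continuousAt_const.add ?_) (by positivity)
  exact Real.continuousAt_rpow_const _ _ (Or.inr (by linarith))

theorem tendsto_ZlMass {l : ℝ} (hl : 0 < l) : Tendsto (ZlMass l) atTop (nhds 0) :=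
  tendsto_const_nhds.div_atTop (tendsto_atTop_add_const_left _ _
    (tendsto_rpow_atTop (by linarith [two_lt_alphaOf hl])))

theorem integrableOn_exp_Zl_mul {l : ℝ} (hl : 0 < l) {a : ℝ} (ha : 0 ≤ a) :
    IntegrableOn (fun t => Real.exp (Zl l t) * t) (Ioi a) :=
  integrableOn_Ioi_deriv_of_nonneg (continuousWithinAt_ZlMass hl ha)
    (fun _ ht => hasDerivAt_ZlMass hl (ha.trans_lt ht))
    (fun _ ht => mul_nonneg (Real.exp_pos _).le (ha.trans_lt ht).le) (tendsto_ZlMass hl)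

theorem integral_exp_Zl_mul {l : ℝ} (hl : 0 < l) {a : ℝ} (ha : 0 ≤ a) :
    (∫ t in Ioi a, Real.exp (Zl l t) * t) = -ZlMass l a := by
  rw [integral_Ioi_of_hasDerivAt_of_nonneg (continuousWithinAt_ZlMass hl ha)
    (fun _ ht => hasDerivAt_ZlMass hl (ha.trans_lt ht))
    (fun _ ht => mul_nonneg (Real.exp_pos _).le (ha.trans_lt ht).le) (tendsto_ZlMass hl),
    zero_sub]

theorem ZlMass_zero {l : ℝ} (hl : 0 < l) : ZlMass l 0 = -(2 * alphaOf l) := by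
  have hB := betaOf_rpow_pos hl
  rw [ZlMass, Real.zero_rpow (by linarith [two_lt_alphaOf hl])]
  field_simp
  ring

theorem ZlMass_self {l : ℝ} (hl : 0 < l) : ZlMass l l = -(alphaOf l + 2) := by
  have ha := two_lt_alphaOf hl
  rw [ZlMass, betaOf_rpow hl]
  have hL := Real.rpow_pos_of_pos hl (alphaOf l)
  generalize l ^ alphaOf l = L at *
  generalize alphaOf l = a at *
  have ha2 : a - 2 ≠ 0 := by linarith
  have : a ≠ 0 := by linarith
  have hD : (a + 2) / (a - 2) * L + L = 2 * a / (a - 2) * L := by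
    field_simp; ring
  rw [hD]
  field_simp

/-- `Z_l` is smooth on `(0,∞)`, solves the radial Liouville equation
`−Z_l'' − Z_l'/r = e^{Z_l}` there, is nonpositive, vanishes to first order at `r = l`,
and satisfies `∫₀^l e^{Z_l}t dt = α−2`, `∫_l^∞ e^{Z_l}t dt = α+2`,
`∫₀^∞ e^{Z_l}t dt = 2α`. -/
theorem Zl_properties (l : ℝ) (hl : 0 < l) :
    ContDiffOn ℝ (⊤ : ℕ∞) (Zl l) (Ioi 0) ∧
    (∀ r, 0 < r → -deriv (deriv (Zl l)) r - deriv (Zl l) r / r = Real.exp (Zl l r)) ∧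
    (∀ r, 0 < r → Zl l r ≤ 0) ∧
    Zl l l = 0 ∧ deriv (Zl l) l = 0 ∧
    (∫ t in (0:ℝ)..l, Real.exp (Zl l t) * t) = alphaOf l - 2 ∧
    (∫ t in Ioi l, Real.exp (Zl l t) * t) = alphaOf l + 2 ∧
    (∫ t in Ioi (0:ℝ), Real.exp (Zl l t) * t) = 2 * alphaOf l := by
  have hI0 := integral_exp_Zl_mul hl le_rfl
  have hIl := integral_exp_Zl_mul hl hl.le
  rw [ZlMass_zero hl, neg_neg] at hI0
  rw [ZlMass_self hl, neg_neg] at hIl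
  refine ⟨contDiffOn_Zl hl, fun r hr => Zl_liouville hl hr, fun r hr => Zl_nonpos hl hr,
    Zl_self hl, deriv_Zl_self hl, ?_, hIl, hI0⟩
  have h := intervalIntegral.integral_interval_add_Ioi (integrableOn_exp_Zl_mul hl le_rfl)
    (integrableOn_exp_Zl_mul hl hl.le)
  rw [hI0, hIl] at h
  linarith
end
end

section
/- For every p > 1 and every r ∈ (0, 1), the solution u_p satisfies the identity u_p'(r)·r·log r − u_p(r) = ∫_r^1 s·log s·|u_p(s)|^{p−1}u_p(s) ds. In particular, taking r = s_p, one gets ∫_{s_p}^1 s·log s·u_p(s)^p ds = −u_p(s_p). -/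
open Real MeasureTheory Set Filter

noncomputable section

/-- If `-Δu = f` holds for a radial profile `u` on `(0, 1)` and `u 1 = 0`, then multiplying by `r log r` and
integrating over `(r, 1)` gives a logarithmic representation formula for `u`. -/
theorem deriv_mul_log_sub_eq_integral {u f : ℝ → ℝ}
    (hu : ContDiffOn ℝ 2 u (Icc (0:ℝ) 1)) (hf : ContinuousOn f (Icc (0:ℝ) 1))
    (hode : ∀ r ∈ Ioo (0:ℝ) 1, -deriv (deriv u) r - deriv u r / r = f r) (hu1 : u 1 = 0)
    {r : ℝ} (hr : r ∈ Ioo (0:ℝ) 1) :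
    deriv u r * r * Real.log r - u r = ∫ s in r..1, s * Real.log s * f s := by
  have hsub : Icc r 1 ⊆ Icc (0:ℝ) 1 := Icc_subset_Icc_left hr.1.le
  have hlog : ContinuousOn Real.log (Icc r 1) :=
    Real.continuousOn_log.mono fun x hx => (hr.1.trans_le hx.1).ne'
  have hw : ContinuousOn (derivWithin u (Icc (0:ℝ) 1)) (Icc r 1) :=
    (hu.continuousOn_derivWithin (uniqueDiffOn_Icc zero_lt_one) (by norm_num)).mono hsub
  have hwd : ∀ x ∈ Ioo (0:ℝ) 1, derivWithin u (Icc (0:ℝ) 1) x = deriv u x := fun x hx =>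
    derivWithin_of_mem_nhds (Icc_mem_nhds hx.1 hx.2)
  have hcont : ContinuousOn
      (fun x => derivWithin u (Icc (0:ℝ) 1) x * x * Real.log x - u x) (Icc r 1) :=
    ((hw.mul continuousOn_id).mul hlog).sub (hu.continuousOn.mono hsub)
  have hderiv : ∀ x ∈ Ioo r 1, HasDerivAt
      (fun x => derivWithin u (Icc (0:ℝ) 1) x * x * Real.log x - u x)
      (-(x * Real.log x * f x)) x := by
    intro x hx
    have hx' : x ∈ Ioo (0:ℝ) 1 := ⟨hr.1.trans hx.1, hx.2⟩
    have hxne : x ≠ 0 := hx'.1.ne'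
    have hnhds : Ioo (0:ℝ) 1 ∈ nhds x := Ioo_mem_nhds hx'.1 hx'.2
    have huo : ContDiffOn ℝ 2 u (Ioo (0:ℝ) 1) := hu.mono Ioo_subset_Icc_self
    have hdu : HasDerivAt u (deriv u x) x :=
      ((huo.differentiableOn (by norm_num)).differentiableAt hnhds).hasDerivAt
    have hd1 : ContDiffOn ℝ 1 (deriv u) (Ioo (0:ℝ) 1) :=
      huo.deriv_of_isOpen isOpen_Ioo (by norm_num)
    have hddu : HasDerivAt (deriv u) (deriv (deriv u) x) x :=
      ((hd1.differentiableOn (by norm_num)).differentiableAt hnhds).hasDerivAt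
    have hmain := ((hddu.mul (hasDerivAt_id x)).mul (Real.hasDerivAt_log hxne)).sub hdu
    refine (hmain.congr_of_eventuallyEq ?_).congr_deriv ?_
    · filter_upwards [hnhds] with y hy
      simp [hwd y hy]
    · rw [← hode x hx']
      simp only [Pi.mul_apply, id]
      field_simp
      ring
  have hint : IntervalIntegrable (fun s => -(s * Real.log s * f s)) volume r 1 :=
    ContinuousOn.intervalIntegrable_of_Icc hr.2.le
      (((continuousOn_id.mul hlog).mul (hf.mono hsub)).neg)
  have h := intervalIntegral.integral_eq_sub_of_hasDerivAt_of_le hr.2.le hcont hderiv hint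
  rw [intervalIntegral.integral_neg, hwd r hr] at h
  simp only [Real.log_one, hu1, mul_zero, sub_zero] at h
  linarith

/-- For every `p > 1` and `r ∈ (0,1)`,
`u_p'(r)·r·log r − u_p(r) = ∫_r^1 s·log s·|u_p(s)|^{p−1}u_p(s) ds`; in particular,
taking `r = s_p` (where `u_p'(s_p) = 0`), `∫_{s_p}^1 s·log s·u_p(s)^p ds = −u_p(s_p)`. -/
theorem log_identity (F : LaneEmdenFamily) (p : ℝ) (hp : 1 < p) :
    (∀ r ∈ Ioo (0:ℝ) 1,
      deriv (F.u p) r * r * Real.log r - F.u p r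
        = ∫ s in r..1, s * Real.log s * (|F.u p s| ^ (p - 1) * F.u p s)) ∧
    (∫ s in (F.sp p)..1, s * Real.log s * F.u p s ^ p) = -F.u p (F.sp p) := by
  have hmain : ∀ r ∈ Ioo (0:ℝ) 1,
      deriv (F.u p) r * r * Real.log r - F.u p r
        = ∫ s in r..1, s * Real.log s * (|F.u p s| ^ (p - 1) * F.u p s) := fun r hr =>
    have hc := (F.smooth p hp).continuousOn
    deriv_mul_log_sub_eq_integral (F.smooth p hp)
      ((hc.abs.rpow_const fun _ _ => Or.inr (sub_pos.2 hp).le).mul hc)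
      (F.ode p hp) (F.boundary p hp) hr
  refine ⟨hmain, ?_⟩
  have hs : F.sp p ∈ Ioo (0:ℝ) 1 :=
    ⟨(F.rp_mem p hp).1.trans (F.sp_mem p hp).1, (F.sp_mem p hp).2⟩
  have hmax : IsLocalMax (F.u p) (F.sp p) := by
    filter_upwards [Icc_mem_nhds hs.1 hs.2] with x hx using F.sp_max p hp x hx
  have h := hmain _ hs
  rw [hmax.deriv_eq_zero, zero_mul, zero_mul, zero_sub] at h
  rw [h]
  refine intervalIntegral.integral_congr fun x hx => ?_
  rw [uIcc_of_le hs.2.le] at hx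
  have hpos : 0 ≤ F.u p x := by
    rcases hx.2.eq_or_lt with rfl | hx1
    · exact (F.boundary p hp).ge
    · exact (F.pos_out p hp x ⟨(F.sp_mem p hp).1.trans_le hx.1, hx1⟩).le
  have hpow := Real.rpow_add_one' hpos (y := p - 1) (by linarith)
  rw [sub_add_cancel] at hpow
  simp only [abs_of_nonneg hpos, hpow]
end
end

section
/- Under the stated limit assumptions, one has 1 = −(1/2)·log(r_∞·u_∞)·(α − 2). -/
open Real MeasureTheory Set Filter

noncomputable section

/-- On `[a, s]` the function `u` with derivative `v` solves `-dv/dr - v / r = u ^ p`, rising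
from a zero at `a` to a critical maximum at `s`. -/
structure IsRisingBranch (p a s : ℝ) (u v : ℝ → ℝ) : Prop where
  one_lt : 1 < p
  left_pos : 0 < a
  lt : a < s
  hasDerivAt : ∀ r ∈ Icc a s, HasDerivAt u (v r) r
  hasDerivAt_deriv : ∀ r ∈ Icc a s, HasDerivAt v (-(v r) / r - u r ^ p) r
  left_zero : u a = 0
  pos : ∀ r ∈ Ioc a s, 0 < u r
  le_right : ∀ r ∈ Icc a s, u r ≤ u s
  right_crit : v s = 0

lemma le_of_hasDerivAt_nonneg {f f' : ℝ → ℝ} {a b : ℝ} (hab : a ≤ b)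
    (hf : ContinuousOn f (Icc a b)) (hf' : ∀ r ∈ Ioo a b, HasDerivAt f (f' r) r)
    (h0 : ∀ r ∈ Ioo a b, 0 ≤ f' r) : f a ≤ f b := by
  refine monotoneOn_of_deriv_nonneg (convex_Icc a b) hf ?_ ?_
    (left_mem_Icc.2 hab) (right_mem_Icc.2 hab) hab
  · rw [interior_Icc]
    exact fun r hr => (hf' r hr).differentiableAt.differentiableWithinAt
  · rw [interior_Icc]
    intro r hr
    rw [(hf' r hr).deriv]
    exact h0 r hr

lemma rpow_mul_sub_le {p x y : ℝ} (hp : 1 < p) (hx : 0 < x) (hxy : x ≤ y) :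
    (p + 1) * (x ^ p * (y - x)) ≤ y ^ (p + 1) := by
  have hb := one_add_mul_self_le_rpow_one_add (s := y / x - 1) (p := p + 1)
    (by linarith [div_nonneg (hx.le.trans hxy) hx.le]) (by linarith)
  rw [add_sub_cancel, div_rpow (hx.le.trans hxy) hx.le, le_div_iff₀ (by positivity)] at hb
  have hxp : 0 < x ^ (p + 1) := by positivity
  have : (y / x - 1) * x ^ (p + 1) = x ^ p * (y - x) := by
    rw [rpow_add_one hx.ne']
    field_simp
  nlinarith

namespace IsRisingBranch

variable {p a s : ℝ} {u v : ℝ → ℝ}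

lemma pos_of_mem (h : IsRisingBranch p a s u v) {r : ℝ} (hr : r ∈ Icc a s) : 0 < r :=
  h.left_pos.trans_le hr.1

lemma nonneg (h : IsRisingBranch p a s u v) {r : ℝ} (hr : r ∈ Icc a s) : 0 ≤ u r := by
  rcases eq_or_lt_of_le hr.1 with rfl | hlt
  · exact h.left_zero.ge
  · exact (h.pos r ⟨hlt, hr.2⟩).le

lemma hasDerivAt_flux (h : IsRisingBranch p a s u v) {r : ℝ} (hr : r ∈ Icc a s) :
    HasDerivAt (fun x => x * v x) (-(r * u r ^ p)) r := by
  have hr0 := (h.pos_of_mem hr).ne'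
  refine HasDerivAt.congr_deriv ((hasDerivAt_id' r).mul (h.hasDerivAt_deriv r hr)) ?_
  field_simp
  ring

lemma flux_le (h : IsRisingBranch p a s u v) {r : ℝ} (hr : r ∈ Icc a s) :
    r * v r ≤ a * v a := by
  have hsub : Icc a r ⊆ Icc a s := Icc_subset_Icc_right hr.2
  have := le_of_hasDerivAt_nonneg (f := fun x => -(x * v x)) hr.1
    (fun x hx => (h.hasDerivAt_flux (hsub hx)).neg.continuousAt.continuousWithinAt)
    (fun x hx => (h.hasDerivAt_flux (hsub (Ioo_subset_Icc_self hx))).neg)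
    (fun x hx => by
      have hx' := hsub (Ioo_subset_Icc_self hx)
      rw [neg_neg]
      exact mul_nonneg (h.pos_of_mem hx').le (rpow_nonneg (h.nonneg hx') _))
  linarith

lemma flux_nonneg (h : IsRisingBranch p a s u v) : 0 ≤ a * v a := by
  have := h.flux_le (right_mem_Icc.2 h.lt.le)
  rwa [h.right_crit, mul_zero] at this

lemma flux_ge (h : IsRisingBranch p a s u v) {r : ℝ} (hr : r ∈ Icc a s) :
    a * v a - u s ^ p * r ^ 2 / 2 ≤ r * v r := by
  have hsub : Icc a r ⊆ Icc a s := Icc_subset_Icc_right hr.2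
  have hd : ∀ x ∈ Icc a r, HasDerivAt (fun x => x * v x + u s ^ p * x ^ 2 / 2)
      (x * (u s ^ p - u x ^ p)) x := fun x hx => by
    refine HasDerivAt.congr_deriv ((h.hasDerivAt_flux (hsub hx)).add
      (((hasDerivAt_pow 2 x).const_mul (u s ^ p)).div_const 2)) ?_
    push_cast
    ring
  have := le_of_hasDerivAt_nonneg hr.1
    (fun x hx => (hd x hx).continuousAt.continuousWithinAt)
    (fun x hx => hd x (Ioo_subset_Icc_self hx))
    (fun x hx => by
      have hx' := hsub (Ioo_subset_Icc_self hx)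
      exact mul_nonneg (h.pos_of_mem hx').le (sub_nonneg.2
        (rpow_le_rpow (h.nonneg hx') (h.le_right x hx') (by linarith [h.one_lt]))))
  have hs : 0 ≤ u s ^ p * a ^ 2 / 2 := by
    have := rpow_nonneg (h.nonneg (right_mem_Icc.2 h.lt.le)) p
    positivity
  linarith

lemma max_le_flux_mul_log (h : IsRisingBranch p a s u v) :
    u s ≤ a * v a * log (s / a) := by
  have hd : ∀ r ∈ Icc a s, HasDerivAt (fun x => a * v a * log x - u x)
      (a * v a * r⁻¹ - v r) r := fun r hr =>
    ((hasDerivAt_log (h.pos_of_mem hr).ne').const_mul _).sub (h.hasDerivAt r hr)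
  have := le_of_hasDerivAt_nonneg h.lt.le
    (fun x hx => (hd x hx).continuousAt.continuousWithinAt)
    (fun x hx => hd x (Ioo_subset_Icc_self hx))
    (fun x hx => by
      have hx' := Ioo_subset_Icc_self hx
      rw [sub_nonneg, ← div_eq_mul_inv, le_div_iff₀ (h.pos_of_mem hx'), mul_comm]
      exact h.flux_le hx')
  rw [log_div (h.left_pos.trans h.lt).ne' h.left_pos.ne']
  linarith [h.left_zero]

lemma flux_mul_log_le (h : IsRisingBranch p a s u v) :
    a * v a * log (s / a) ≤ u s + u s ^ p * s ^ 2 / 4 := by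
  have hd : ∀ r ∈ Icc a s, HasDerivAt
      (fun x => u x + u s ^ p * x ^ 2 / 4 - a * v a * log x)
      (v r + u s ^ p * r / 2 - a * v a * r⁻¹) r := fun r hr => by
    refine HasDerivAt.congr_deriv (((h.hasDerivAt r hr).add
      (((hasDerivAt_pow 2 r).const_mul (u s ^ p)).div_const 4)).sub
      ((hasDerivAt_log (h.pos_of_mem hr).ne').const_mul (a * v a))) ?_
    push_cast
    ring
  have := le_of_hasDerivAt_nonneg h.lt.le
    (fun x hx => (hd x hx).continuousAt.continuousWithinAt)
    (fun x hx => hd x (Ioo_subset_Icc_self hx))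
    (fun x hx => by
      have hx' := Ioo_subset_Icc_self hx
      rw [sub_nonneg, ← div_eq_mul_inv, div_le_iff₀ (h.pos_of_mem hx')]
      linarith [h.flux_ge hx'])
  have hs : 0 ≤ u s ^ p * a ^ 2 / 4 := by
    have := rpow_nonneg (h.nonneg (right_mem_Icc.2 h.lt.le)) p
    positivity
  rw [log_div (h.left_pos.trans h.lt).ne' h.left_pos.ne']
  linarith [h.left_zero]

/-- The Pohozaev functional, corrected by a multiple of the flux so that it is almost conserved. -/
def pohozaev (p s : ℝ) (u v : ℝ → ℝ) (r : ℝ) : ℝ :=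
  (r * v r) ^ 2 + 2 / (p + 1) * (r ^ 2 * u r ^ (p + 1)) + 4 / (p + 1) * u s * (r * v r)

lemma hasDerivAt_pohozaev (h : IsRisingBranch p a s u v) {r : ℝ} (hr : r ∈ Icc a s) :
    HasDerivAt (pohozaev p s u v) (-(4 / (p + 1) * r * (u r ^ p * (u s - u r)))) r := by
  have hp := h.one_lt
  have hp1 : p + 1 ≠ 0 := by linarith
  have hpow : HasDerivAt (fun x => u x ^ (p + 1)) (v r * (p + 1) * u r ^ p) r := by
    convert (h.hasDerivAt r hr).rpow_const (p := p + 1) (Or.inr (by linarith)) using 2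
    ring_nf
  have hmul : u r ^ (p + 1) = u r ^ p * u r := by
    rw [rpow_add_one' (h.nonneg hr) hp1]
  refine HasDerivAt.congr_deriv ((((h.hasDerivAt_flux hr).pow 2).add
    (((hasDerivAt_pow 2 r).mul hpow).const_mul (2 / (p + 1)))).add
    ((h.hasDerivAt_flux hr).const_mul (4 / (p + 1) * u s))) ?_
  rw [hmul]
  field_simp
  push_cast
  ring

lemma pohozaev_left (h : IsRisingBranch p a s u v) :
    pohozaev p s u v a = (a * v a) ^ 2 + 4 / (p + 1) * u s * (a * v a) := by
  have : (0 : ℝ) ^ (p + 1) = 0 := zero_rpow (by linarith [h.one_lt])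
  simp [pohozaev, h.left_zero, this]

lemma pohozaev_right (h : IsRisingBranch p a s u v) :
    pohozaev p s u v s = 2 / (p + 1) * (s ^ 2 * u s ^ (p + 1)) := by
  simp [pohozaev, h.right_crit]

lemma pohozaev_lower (h : IsRisingBranch p a s u v) :
    2 / (p + 1) * (s ^ 2 * u s ^ (p + 1))
      ≤ (a * v a) ^ 2 + 4 / (p + 1) * u s * (a * v a) := by
  rw [← h.pohozaev_left, ← h.pohozaev_right]
  have := le_of_hasDerivAt_nonneg (f := fun x => -pohozaev p s u v x) h.lt.le
    (fun x hx => (h.hasDerivAt_pohozaev hx).neg.continuousAt.continuousWithinAt)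
    (fun x hx => (h.hasDerivAt_pohozaev (Ioo_subset_Icc_self hx)).neg)
    (fun x hx => by
      have hx' := Ioo_subset_Icc_self hx
      have h1 := h.one_lt
      have h2 := h.pos_of_mem hx'
      have h3 := rpow_nonneg (h.nonneg hx') p
      have h4 := sub_nonneg.2 (h.le_right x hx')
      rw [neg_neg]
      positivity)
  linarith

lemma pohozaev_upper (h : IsRisingBranch p a s u v) :
    (a * v a) ^ 2 + 4 / (p + 1) * u s * (a * v a)
      ≤ 2 / (p + 1) * (s ^ 2 * u s ^ (p + 1))
        + 2 / (p + 1) ^ 2 * (s ^ 2 * u s ^ (p + 1)) := by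
  rw [← h.pohozaev_left, ← h.pohozaev_right]
  have hp := h.one_lt
  have hd : ∀ r ∈ Icc a s, HasDerivAt
      (fun x => pohozaev p s u v x + 2 / (p + 1) ^ 2 * (x ^ 2 * u s ^ (p + 1)))
      (4 / (p + 1) ^ 2 * r * (u s ^ (p + 1) - (p + 1) * (u r ^ p * (u s - u r)))) r :=
    fun r hr => by
      refine HasDerivAt.congr_deriv ((h.hasDerivAt_pohozaev hr).add
        (((hasDerivAt_pow 2 r).mul_const (u s ^ (p + 1))).const_mul (2 / (p + 1) ^ 2))) ?_
      field_simp
      push_cast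
      ring
  have := le_of_hasDerivAt_nonneg h.lt.le
    (fun x hx => (hd x hx).continuousAt.continuousWithinAt)
    (fun x hx => hd x (Ioo_subset_Icc_self hx))
    (fun x hx => by
      have hx' := Ioo_subset_Icc_self hx
      have h2 := h.pos_of_mem hx'
      have h3 := sub_nonneg.2
        (rpow_mul_sub_le hp (h.pos x (Ioo_subset_Ioc_self hx)) (h.le_right x hx'))
      positivity)
  have hs : 0 ≤ 2 / (p + 1) ^ 2 * (a ^ 2 * u s ^ (p + 1)) := by
    have := rpow_nonneg (h.nonneg (right_mem_Icc.2 h.lt.le)) (p + 1)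
    positivity
  linarith

lemma right_pos (h : IsRisingBranch p a s u v) : 0 < u s :=
  h.pos s (right_mem_Ioc.2 h.lt)

lemma le_scaledFlux_mul_log (h : IsRisingBranch p a s u v) :
    p ≤ p / u s * (a * v a) * log (s / a) := by
  have hp := h.one_lt
  have hU := h.right_pos
  calc p = p / u s * u s := by field_simp
    _ ≤ p / u s * (a * v a * log (s / a)) := by gcongr; exact h.max_le_flux_mul_log
    _ = _ := by ring

lemma scaledFlux_mul_log_le (h : IsRisingBranch p a s u v) :
    p / u s * (a * v a) * log (s / a) ≤ p + s ^ 2 * (p * u s ^ (p - 1)) / 4 := by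
  have hp := h.one_lt
  have hU := h.right_pos
  calc p / u s * (a * v a) * log (s / a) = p / u s * (a * v a * log (s / a)) := by ring
    _ ≤ p / u s * (u s + u s ^ p * s ^ 2 / 4) := by gcongr; exact h.flux_mul_log_le
    _ = _ := by
      rw [rpow_sub_one hU.ne']
      field_simp

lemma scaledFlux_quadratic_mem (h : IsRisingBranch p a s u v) :
    (p / u s * (a * v a)) ^ 2 + 4 * (p / (p + 1)) * (p / u s * (a * v a)) ∈
      Icc (2 * (p / (p + 1)) * (s ^ 2 * (p * u s ^ (p - 1))))
        (2 * (p / (p + 1)) * (s ^ 2 * (p * u s ^ (p - 1)))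
          + 2 * (p / (p + 1)) * (1 / (p + 1)) * (s ^ 2 * (p * u s ^ (p - 1)))) := by
  have hp := h.one_lt
  have hU := h.right_pos
  have e1 : (p / u s * (a * v a)) ^ 2 + 4 * (p / (p + 1)) * (p / u s * (a * v a))
      = (p / u s) ^ 2 * ((a * v a) ^ 2 + 4 / (p + 1) * u s * (a * v a)) := by
    field_simp
  have e2 : u s ^ (p + 1) = u s ^ (p - 1) * u s ^ 2 := by
    rw [← rpow_natCast, ← rpow_add hU]
    norm_num
    ring_nf
  rw [e1]
  constructor
  · calc _ = (p / u s) ^ 2 * (2 / (p + 1) * (s ^ 2 * u s ^ (p + 1))) := by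
          rw [e2]; field_simp
      _ ≤ _ := by gcongr; exact h.pohozaev_lower
  · calc _ ≤ (p / u s) ^ 2 * (2 / (p + 1) * (s ^ 2 * u s ^ (p + 1))
          + 2 / (p + 1) ^ 2 * (s ^ 2 * u s ^ (p + 1))) := 
          mul_le_mul_of_nonneg_left h.pohozaev_upper (sq_nonneg _)
      _ = _ := by rw [e2]; field_simp

end IsRisingBranch

lemma LaneEmdenFamily.isRisingBranch (F : LaneEmdenFamily) {p : ℝ} (hp : 1 < p) :
    IsRisingBranch p (F.rp p) (F.sp p) (F.u p) (deriv (F.u p)) := by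
  have ha := F.rp_mem p hp
  have hs := F.sp_mem p hp
  have hsub : Icc (F.rp p) (F.sp p) ⊆ Ioo 0 1 := fun r hr =>
    ⟨ha.1.trans_le hr.1, hr.2.trans_lt hs.2⟩
  have hC : ContDiffOn ℝ 2 (F.u p) (Ioo 0 1) := (F.smooth p hp).mono Ioo_subset_Icc_self
  have hpos : ∀ r ∈ Ioc (F.rp p) (F.sp p), 0 < F.u p r := fun r hr =>
    F.pos_out p hp r ⟨hr.1, hr.2.trans_lt hs.2⟩
  refine
    { one_lt := hp
      left_pos := ha.1
      lt := hs.1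
      hasDerivAt := fun r hr => ?_
      hasDerivAt_deriv := fun r hr => ?_
      left_zero := F.rp_zero p hp
      pos := hpos
      le_right := fun r hr => F.sp_max p hp r (Ioo_subset_Icc_self (hsub hr))
      right_crit := ?_ }
  · exact ((hC.differentiableOn (by norm_num)).differentiableAt
      (isOpen_Ioo.mem_nhds (hsub hr))).hasDerivAt
  · have hd : ContDiffOn ℝ 1 (deriv (F.u p)) (Ioo 0 1) :=
      hC.deriv_of_isOpen isOpen_Ioo (by norm_num)
    have h1 := ((hd.differentiableOn (by norm_num)).differentiableAt
      (isOpen_Ioo.mem_nhds (hsub hr))).hasDerivAt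
    have hode := F.ode p hp r (hsub hr)
    have habs : |F.u p r| ^ (p - 1) * F.u p r = F.u p r ^ p := by
      rcases eq_or_lt_of_le hr.1 with rfl | hlt
      · rw [F.rp_zero p hp, mul_zero, zero_rpow (by linarith)]
      · have h0 := hpos r ⟨hlt, hr.2⟩
        rw [abs_of_pos h0, rpow_sub_one h0.ne', div_mul_cancel₀ _ h0.ne']
    refine h1.congr_deriv ?_
    rw [← habs, ← hode]
    ring
  · refine IsLocalMax.deriv_eq_zero ?_
    filter_upwards [isOpen_Ioo.mem_nhds (hsub (right_mem_Icc.2 hs.1.le))] with r hr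
    exact F.sp_max p hp r (Ioo_subset_Icc_self hr)

lemma sp_div_epsP_sq (F : LaneEmdenFamily) {p : ℝ} (hp : 1 < p) :
    (F.sp p / epsP F p) ^ 2 = F.sp p ^ 2 * (p * F.u p (F.sp p) ^ (p - 1)) := by
  have hU := (F.isRisingBranch hp).right_pos
  rw [epsP, div_div_eq_mul_div, div_one, mul_pow, sq_sqrt (by positivity)]

lemma log_sp_div_rp (F : LaneEmdenFamily) {p : ℝ} (hp : 1 < p) :
    log (F.sp p / F.rp p) = log (F.sp p / epsP F p) - log p / 2
      - (p - 1) / 2 * (log (F.u p (F.sp p)) + log (F.rp p ^ (2 / (p - 1)))) := by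
  have h := F.isRisingBranch hp
  have hU := h.right_pos
  have hr := h.left_pos
  have hs := hr.trans h.lt
  have hp0 : 0 < p := by linarith
  have hp1 : p - 1 ≠ 0 := by linarith
  rw [epsP, div_div_eq_mul_div, div_one, log_mul hs.ne' (by positivity),
    log_sqrt (by positivity), log_mul hp0.ne' (by positivity), log_rpow hU, log_rpow hr,
    log_div hs.ne' hr.ne']
  field_simp
  ring

/-- Under the stated limit assumptions (with `α = √(2l²+4)`), one has `1 = −(1/2)·log(r_∞·u_∞)·(α − 2)`. -/
theorem one_eq_neg_half_log (F : LaneEmdenFamily) (pn : ℕ → ℝ) (hpn : ∀ n, 1 < pn n)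
    (hto : Tendsto pn atTop atTop) (l rinf uinf : ℝ)
    (hl : 0 < l) (hrinf : 0 < rinf) (hrinf1 : rinf ≤ 1) (huinf : 0 < uinf)
    (hlimL : Tendsto (fun n => F.sp (pn n) / epsP F (pn n)) atTop (nhds l))
    (hlimR : Tendsto (fun n => F.rp (pn n) ^ (2 / (pn n - 1))) atTop (nhds rinf))
    (hlimU : Tendsto (fun n => F.u (pn n) (F.sp (pn n))) atTop (nhds uinf)) :
    1 = -(1 / 2) * Real.log (rinf * uinf) * (alphaOf l - 2) := by
  set X : ℕ → ℝ := fun n => F.sp (pn n) / epsP F (pn n) with hX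
  set m : ℕ → ℝ := fun n =>
    pn n / F.u (pn n) (F.sp (pn n)) * (F.rp (pn n) * deriv (F.u (pn n)) (F.rp (pn n))) with hm
  set L : ℕ → ℝ := fun n => log (F.sp (pn n) / F.rp (pn n)) with hL
  have hp0 : ∀ n, 0 < pn n := fun n => by linarith [hpn n]
  have hbr := fun n => F.isRisingBranch (hpn n)
  have hm0 : ∀ n, 0 ≤ m n := fun n =>
    mul_nonneg (div_nonneg (hp0 n).le (hbr n).right_pos.le) (hbr n).flux_nonneg
  have hinv : Tendsto (fun n => (pn n)⁻¹) atTop (nhds 0) := tendsto_inv_atTop_zero.comp hto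
  have hinv1 : Tendsto (fun n => 1 / (pn n + 1)) atTop (nhds 0) := by
    simpa [Function.comp_def] using
      tendsto_inv_atTop_zero.comp (tendsto_atTop_add_const_right _ (1 : ℝ) hto)
  have hratio : Tendsto (fun n => pn n / (pn n + 1)) atTop (nhds 1) := by
    have : Tendsto (fun n => 1 - 1 / (pn n + 1)) atTop (nhds (1 - 0)) := hinv1.const_sub 1
    rw [sub_zero] at this
    refine this.congr fun n => ?_
    have := hp0 n
    field_simp
    ring
  have hX2 : Tendsto (fun n => X n ^ 2) atTop (nhds (l ^ 2)) := hlimL.pow 2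
  -- The Pohozaev identity identifies the limit of the scaled flux.
  have hquad : Tendsto (fun n => m n ^ 2 + 4 * (pn n / (pn n + 1)) * m n) atTop
      (nhds (2 * l ^ 2)) := by
    have hlow : Tendsto (fun n => 2 * (pn n / (pn n + 1)) * X n ^ 2) atTop
        (nhds (2 * l ^ 2)) := by
      simpa using (hratio.const_mul 2).mul hX2
    have hup : Tendsto (fun n => 2 * (pn n / (pn n + 1)) * X n ^ 2
        + 2 * (pn n / (pn n + 1)) * (1 / (pn n + 1)) * X n ^ 2) atTop (nhds (2 * l ^ 2)) := by
      simpa using hlow.add ((((hratio.const_mul 2).mul hinv1)).mul hX2)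
    refine tendsto_of_tendsto_of_tendsto_of_le_of_le hlow hup (fun n => ?_) (fun n => ?_)
    · simp only [hX, sp_div_epsP_sq F (hpn n)]
      exact (hbr n).scaledFlux_quadratic_mem.1
    · simp only [hX, sp_div_epsP_sq F (hpn n)]
      exact (hbr n).scaledFlux_quadratic_mem.2
  have hmlim : Tendsto m atTop (nhds (alphaOf l - 2)) := by
    have hsqrt : Tendsto (fun n => √(m n ^ 2 + 4 * (pn n / (pn n + 1)) * m n
        + (2 * (pn n / (pn n + 1))) ^ 2) - 2 * (pn n / (pn n + 1))) atTop
        (nhds (√(2 * l ^ 2 + (2 * 1) ^ 2) - 2 * 1)) :=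
      ((hquad.add ((hratio.const_mul 2).pow 2)).sqrt).sub (hratio.const_mul 2)
    have hlim : √(2 * l ^ 2 + (2 * 1) ^ 2) - 2 * 1 = alphaOf l - 2 := by
      rw [alphaOf]
      norm_num
    rw [hlim] at hsqrt
    refine hsqrt.congr fun n => ?_
    have h1 : 0 ≤ pn n / (pn n + 1) := by
      have := hp0 n
      positivity
    have h2 := hm0 n
    rw [show m n ^ 2 + 4 * (pn n / (pn n + 1)) * m n + (2 * (pn n / (pn n + 1))) ^ 2
      = (m n + 2 * (pn n / (pn n + 1))) ^ 2 by ring, sqrt_sq (by positivity)]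
    ring
  have hlogp : Tendsto (fun n => log (pn n) * (pn n)⁻¹) atTop (nhds 0) := by
    simpa [div_eq_mul_inv, Function.comp_def] using
      (isLittleO_log_id_atTop.tendsto_div_nhds_zero).comp hto
  have hLlim : Tendsto (fun n => L n * (pn n)⁻¹) atTop
      (nhds (-(1 / 2) * log (rinf * uinf))) := by
    have h1 : Tendsto (fun n => log (X n) * (pn n)⁻¹ - 1 / 2 * (log (pn n) * (pn n)⁻¹)
        - (1 - (pn n)⁻¹) / 2 * (log (F.u (pn n) (F.sp (pn n)))
          + log (F.rp (pn n) ^ (2 / (pn n - 1))))) atTop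
        (nhds (log l * 0 - 1 / 2 * 0 - (1 - 0) / 2 * (log uinf + log rinf))) :=
      (((hlimL.log hl.ne').mul hinv).sub (hlogp.const_mul _)).sub
        (((hinv.const_sub 1).div_const 2).mul ((hlimU.log huinf.ne').add (hlimR.log hrinf.ne')))
    have h2 : log l * 0 - 1 / 2 * 0 - (1 - 0) / 2 * (log uinf + log rinf)
        = -(1 / 2) * log (rinf * uinf) := by
      rw [log_mul hrinf.ne' huinf.ne']
      ring
    rw [h2] at h1
    refine h1.congr fun n => ?_
    have := (hp0 n).ne'
    simp only [hL, hX, log_sp_div_rp F (hpn n)]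
    field_simp
  have hone : Tendsto (fun n => m n * (L n * (pn n)⁻¹)) atTop (nhds 1) := by
    have hup : Tendsto (fun n => 1 + X n ^ 2 / 4 * (pn n)⁻¹) atTop (nhds 1) := by
      simpa using ((hX2.div_const 4).mul hinv).const_add 1
    refine tendsto_of_tendsto_of_tendsto_of_le_of_le tendsto_const_nhds hup
      (fun n => ?_) (fun n => ?_)
    · have := (hbr n).le_scaledFlux_mul_log
      change 1 ≤ m n * (L n * (pn n)⁻¹)
      rw [← mul_assoc, ← div_eq_mul_inv, le_div_iff₀ (hp0 n), one_mul]
      exact this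
    · have := (hbr n).scaledFlux_mul_log_le
      rw [← sp_div_epsP_sq F (hpn n)] at this
      change m n * (L n * (pn n)⁻¹) ≤ 1 + X n ^ 2 / 4 * (pn n)⁻¹
      have h0 := hp0 n
      rw [← mul_assoc, ← div_eq_mul_inv, div_le_iff₀ h0, add_mul, one_mul,
        inv_mul_cancel_right₀ h0.ne']
      exact this
  rw [mul_comm]
  exact tendsto_nhds_unique hone (hmlim.mul hLlim)
end
end
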